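/- Let n, m be positive integers and k a weight vector. If Θ ∈ Bad(k,n,m), then for every d with 1 ≤ d ≤ n and every d-dimensional affine subspace A ⊆ ℝⁿ, the Hausdorff dimension of Bad_Θ(k,n,m) ∩ A equals d. -/

import Mathlib

open Real MeasureTheory Topology

/-- Distance from a real number to the nearest integer. -/
noncomputable def distNearestInt (y : ℝ) : ℝ := ⨅ p : ℤ, |y - (p : ℝ)|

/-- `Θᵢ(q) = ∑ⱼ qⱼ Θᵢⱼ` : the `i`-th linear form of `Θ` evaluated at `q ∈ ℤᵐ`. -/
noncomputable def linForm {n m : ℕ} (Θ : Matrix (Fin n) (Fin m) ℝ) (q : Fin m → ℤ)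
    (i : Fin n) : ℝ := ∑ j, (q j : ℝ) * Θ i j

/-- `Θ*ⱼ(u) = ∑ᵢ uᵢ Θᵢⱼ` : the `j`-th linear form of the transposed matrix `Θ*`. -/
noncomputable def dualForm {n m : ℕ} (Θ : Matrix (Fin n) (Fin m) ℝ) (u : Fin n → ℤ)
    (j : Fin m) : ℝ := ∑ i, (u i : ℝ) * Θ i j

/-- The supremum norm `|q|` of an integer vector. -/
noncomputable def supNorm {m : ℕ} (q : Fin m → ℤ) : ℝ := ⨆ j, |(q j : ℝ)|

/-- A weight vector: positive entries summing to 1. -/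
def IsWeight {n : ℕ} (k : Fin n → ℝ) : Prop := (∀ i, 0 < k i) ∧ ∑ i, k i = 1

/-- The set `Bad(k,n,m)` of weighted badly approximable `n × m` matrices:
`inf_{q ∈ ℤᵐ, q ≠ 0} max_{1≤i≤n} |q|^{m kᵢ} ‖Θᵢ(q)‖ > 0`. -/
def Bad (n m : ℕ) (k : Fin n → ℝ) : Set (Matrix (Fin n) (Fin m) ℝ) :=
  {Θ | ∃ c > 0, ∀ q : Fin m → ℤ, q ≠ 0 →
    c ≤ ⨆ i, supNorm q ^ ((m : ℝ) * k i) * distNearestInt (linForm Θ q i)}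

/-- The twisted set `Bad_Θ(k,n,m)`:
`{x ∈ ℝⁿ : inf_{q ∈ ℤᵐ, q ≠ 0} max_{1≤i≤n} |q|^{m kᵢ} ‖Θᵢ(q) − xᵢ‖ > 0}`. -/
def BadT (n m : ℕ) (k : Fin n → ℝ) (Θ : Matrix (Fin n) (Fin m) ℝ) : Set (Fin n → ℝ) :=
  {x | ∃ c > 0, ∀ q : Fin m → ℤ, q ≠ 0 →
    c ≤ ⨆ i, supNorm q ^ ((m : ℝ) * k i) * distNearestInt (linForm Θ q i - x i)}

open Set in
theorem dimH_range_le_of_edist_le_rpow {Ω X Y : Type*} [EMetricSpace X] [EMetricSpace Y]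
    (p : Ω → X) (f : Ω → Y) (C r : NNReal) (hr : 0 < r)
    (h : ∀ a b, edist (f a) (f b) ≤ C * edist (p a) (p b) ^ (r : ℝ)) :
    dimH (range f) ≤ dimH (range p) / r := by
  rcases isEmpty_or_nonempty Ω with hΩ | hΩ
  · simp [range_eq_empty]
  have key : ∀ a, f (Function.invFun p (p a)) = f a := by
    intro a
    have h1 := h (Function.invFun p (p a)) a
    rw [Function.invFun_eq (f := p) ⟨a, rfl⟩, edist_self, ENNReal.zero_rpow_of_pos (by exact_mod_cast hr),
      mul_zero] at h1
    exact edist_le_zero.1 h1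
  have himg : (f ∘ Function.invFun p) '' range p = range f := by
    rw [← range_comp]
    congr 1
    funext a
    exact key a
  rw [← himg]
  refine HolderOnWith.dimH_image_le (C := C) ?_ hr
  rintro _ ⟨a, rfl⟩ _ ⟨b, rfl⟩
  simp only [Function.comp_apply, key]
  exact h a b

/-- Centres of the cells of a Cantor construction in which the cell with centre `z` at level `t` is
first moved to `g t z` and then subdivided by a grid of mesh `s t`. -/
noncomputable def cantorCenter {d N : ℕ} (g : ℕ → (Fin d → ℝ) → Fin d → ℝ) (s : ℕ → ℝ)
    (ω : ℕ → Fin d → Fin N) : ℕ → Fin d → ℝ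
  | 0 => 0
  | t + 1 => g t (cantorCenter g s ω t) + s t • fun i => ((ω t i : ℕ) : ℝ)

theorem cantorCenter_congr {d N : ℕ} (g : ℕ → (Fin d → ℝ) → Fin d → ℝ) (s : ℕ → ℝ)
    {ω ω' : ℕ → Fin d → Fin N} {t : ℕ} (h : ∀ i < t, ω i = ω' i) :
    cantorCenter g s ω t = cantorCenter g s ω' t := by
  induction t with
  | zero => rfl
  | succ t ih =>
    simp only [cantorCenter, ih fun i hi => h i (hi.trans t.lt_succ_self), h t t.lt_succ_self]

open Metric in
theorem mul_log_div_log_le_dimH {d N : ℕ} (hN : 1 < N) {ρ r₀ : ℝ} (hρ : 0 < ρ) (hρ1 : ρ ≤ 1)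
    (hr₀ : 0 < r₀) (S : Set (Fin d → ℝ)) (D : ℕ → Set (Fin d → ℝ))
    (hS : ∀ x, (∀ t, x ∉ D t) → x ∈ S)
    (hD : ∀ t z, ∃ z', closedBall z' (ρ * (r₀ * (ρ / (6 * N)) ^ t)) ⊆
      closedBall z (r₀ * (ρ / (6 * N)) ^ t) \ D t) :
    (d : ENNReal) * ENNReal.ofReal (log N / log (6 * N / ρ)) ≤ dimH S := by
  have hN' : (1 : ℝ) < N := by exact_mod_cast hN
  set β : ℝ := ρ / (6 * N) with hβ
  have hβ0 : 0 < β := by positivity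
  have hβρ : 6 * (N * β) = ρ := by rw [hβ]; field_simp
  have hβ1 : β < 1 := by nlinarith
  choose g hg using hD
  set c := cantorCenter (N := N) g (fun t => 3 * (r₀ * β ^ (t + 1))) with hc
  have hr : ∀ t, 0 < r₀ * β ^ t := fun t => by positivity
  have hchild : ∀ ω t, closedBall (c ω (t + 1)) (r₀ * β ^ (t + 1)) ⊆
      closedBall (g t (c ω t)) (ρ * (r₀ * β ^ t)) := by
    intro ω t
    apply closedBall_subset_closedBall'
    have h1 : dist (c ω (t + 1)) (g t (c ω t)) ≤ 3 * (r₀ * β ^ (t + 1)) * (N - 1) := by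
      have h2 : c ω (t + 1) = g t (c ω t) +
        (3 * (r₀ * β ^ (t + 1))) • fun i => ((ω t i : ℕ) : ℝ) := rfl
      rw [h2, dist_eq_norm, add_sub_cancel_left, norm_smul, Real.norm_of_nonneg (by positivity)]
      gcongr
      rw [pi_norm_le_iff_of_nonneg (by linarith)]
      intro i
      rw [Real.norm_of_nonneg (by positivity), le_sub_iff_add_le]
      exact_mod_cast (ω t i).2
    have h3 := hr t
    have h4 := hr (t + 1)
    rw [← hβρ]
    have h5 : 6 * (N * β) * (r₀ * β ^ t) = 6 * N * (r₀ * β ^ (t + 1)) := by ring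
    rw [h5]
    nlinarith
  have hnest : ∀ ω t, closedBall (c ω (t + 1)) (r₀ * β ^ (t + 1)) ⊆
      closedBall (c ω t) (r₀ * β ^ t) \ D t :=
    fun ω t => (hchild ω t).trans (hg t (c ω t))
  have hpt : ∀ ω, ∃ x, ∀ t, x ∈ closedBall (c ω t) (r₀ * β ^ t) := by
    intro ω
    obtain ⟨x, hx⟩ := IsCompact.nonempty_iInter_of_sequence_nonempty_isCompact_isClosed
      (fun t => closedBall (c ω t) (r₀ * β ^ t))
      (fun t => (hnest ω t).trans Set.sdiff_subset)
      (fun t => nonempty_closedBall.2 (hr t).le) (isCompact_closedBall _ _)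
      (fun t => isClosed_closedBall)
    exact ⟨x, Set.mem_iInter.1 hx⟩
  choose p hp using hpt
  have hpS : Set.range p ⊆ S := by
    rintro _ ⟨ω, rfl⟩
    exact hS _ fun t => (hnest ω t (hp ω (t + 1))).2
  have hsep : ∀ ω ω' t, (∀ i < t, ω i = ω' i) → ω t ≠ ω' t →
      r₀ * β ^ (t + 1) ≤ dist (p ω) (p ω') := by
    intro ω ω' t hlt hne
    obtain ⟨i, hi⟩ := Function.ne_iff.1 hne
    have h1 := (dist_le_pi_dist _ _ i).trans (hp ω (t + 1))
    have h2 := (dist_le_pi_dist _ _ i).trans (hp ω' (t + 1))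
    refine le_trans ?_ (dist_le_pi_dist _ _ i)
    have h3 : c ω (t + 1) i = g t (c ω t) i + 3 * (r₀ * β ^ (t + 1)) * ((ω t i : ℕ) : ℝ) := rfl
    have h4 : c ω' (t + 1) i = g t (c ω t) i + 3 * (r₀ * β ^ (t + 1)) * ((ω' t i : ℕ) : ℝ) := by
      rw [hc, cantorCenter_congr g _ hlt]; rfl
    have h5 : 3 * (r₀ * β ^ (t + 1)) ≤ dist (c ω (t + 1) i) (c ω' (t + 1) i) := by
      rw [Real.dist_eq, h3, h4, add_sub_add_left_eq_sub, ← mul_sub, abs_mul,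
        abs_of_pos (by have := hr (t + 1); positivity)]
      have h6 : (1 : ℝ) ≤ |((ω t i : ℕ) : ℝ) - ((ω' t i : ℕ) : ℝ)| := by
        have : (1 : ℤ) ≤ |((ω t i : ℕ) : ℤ) - ((ω' t i : ℕ) : ℤ)| := by
          have := Fin.val_ne_of_ne hi
          apply Int.one_le_abs
          omega
        exact_mod_cast this
      have := hr (t + 1)
      nlinarith
    have h6 := dist_triangle4 (c ω (t + 1) i) (p ω i) (p ω' i) (c ω' (t + 1) i)
    rw [dist_comm] at h1
    linarith
  set f : (ℕ → Fin d → Fin N) → Fin d → ℝ := fun ω i => ofDigits fun t => ω t i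
  have hfd : ∀ ω ω' t, (∀ i < t, ω i = ω' i) → dist (f ω) (f ω') ≤ ((N : ℝ) ^ t)⁻¹ := by
    intro ω ω' t hlt
    rw [dist_pi_le_iff (by positivity)]
    intro i
    rw [Real.dist_eq]
    exact abs_ofDigits_sub_ofDigits_le fun j hj => by rw [hlt j hj]
  have hrange : Set.Icc 0 1 ⊆ Set.range f := by
    intro y hy
    have : ∀ i, ∃ a : ℕ → Fin N, ofDigits a = y i := fun i => by
      obtain ⟨a, -, ha⟩ := ofDigits_SurjOn hN ⟨hy.1 i, hy.2 i⟩
      exact ⟨a, ha⟩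
    choose a ha using this
    exact ⟨fun t i => a i t, funext ha⟩
  have hdim : (d : ENNReal) ≤ dimH (Set.range f) := by
    rw [← Real.dimH_univ_pi_fin d]
    refine le_trans (le_of_eq ?_) (dimH_mono hrange)
    rw [Real.dimH_univ_pi_fin, Real.dimH_of_nonempty_interior, Module.finrank_fin_fun]
    rw [← Set.pi_univ_Icc, interior_pi_set Set.finite_univ]
    exact ⟨fun _ => 1 / 2, fun i _ => by simp [interior_Icc]; norm_num⟩
  have hlogN : 0 < log N := Real.log_pos hN'
  have hβinv : 6 * N / ρ = β⁻¹ := by rw [hβ, inv_div]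
  have hlogβ : 0 < log β⁻¹ := Real.log_pos (one_lt_inv_iff₀.2 ⟨hβ0, hβ1⟩)
  rw [hβinv]
  set s : NNReal := ⟨log N / log β⁻¹, by positivity⟩
  have hs0 : 0 < s := by
    rw [← NNReal.coe_pos]; exact div_pos hlogN hlogβ
  have hβs : β ^ (s : ℝ) = (N : ℝ)⁻¹ := by
    rw [Real.rpow_def_of_pos hβ0, ← Real.exp_log (show (0 : ℝ) < (N : ℝ)⁻¹ by positivity)]
    congr 1
    change log β * (log N / log β⁻¹) = _
    rw [Real.log_inv] at hlogβ ⊢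
    rw [Real.log_inv]
    have : log β ≠ 0 := by linarith
    field_simp
  have hH : ∀ ω ω', edist (f ω) (f ω') ≤
      (((r₀ * β) ^ (s : ℝ))⁻¹).toNNReal * edist (p ω) (p ω') ^ (s : ℝ) := by
    intro ω ω'
    by_cases heq : ω = ω'
    · simp [heq]
    have hex : ∃ t, ω t ≠ ω' t := Function.ne_iff.1 heq
    classical
    have hlt : ∀ i < Nat.find hex, ω i = ω' i := fun i hi => not_not.1 (Nat.find_min hex hi)
    have h1 := hsep ω ω' _ hlt (Nat.find_spec hex)
    have h2 := hfd ω ω' _ hlt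
    set t := Nat.find hex
    rw [edist_dist, edist_dist, ENNReal.ofReal_rpow_of_nonneg dist_nonneg s.coe_nonneg]
    change _ ≤ ENNReal.ofReal _ * _
    rw [← ENNReal.ofReal_mul (by positivity)]
    apply ENNReal.ofReal_le_ofReal
    refine h2.trans ?_
    rw [inv_mul_eq_div, le_div_iff₀ (by positivity)]
    refine le_trans (le_of_eq ?_) (Real.rpow_le_rpow (hr (t + 1)).le h1 s.coe_nonneg)
    have h3 : (β ^ t) ^ (s : ℝ) = ((N : ℝ) ^ t)⁻¹ := by
      rw [← Real.rpow_natCast, ← Real.rpow_mul hβ0.le, mul_comm, Real.rpow_mul hβ0.le, hβs,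
        Real.rpow_natCast, inv_pow]
    rw [pow_succ', ← mul_assoc, Real.mul_rpow (x := r₀ * β) (by positivity) (by positivity), h3,
      mul_comm]
  have h3 := hdim.trans (dimH_range_le_of_edist_le_rpow p f _ s hs0 hH)
  rw [ENNReal.le_div_iff_mul_le (by simp [hs0.ne']) (by simp)] at h3
  have h4 : ENNReal.ofReal (log N / log β⁻¹) = s := by
    rw [← ENNReal.ofReal_coe_nnreal]; rfl
  rw [h4]
  exact h3.trans (dimH_mono hpS)

open Filter Metric in
theorem natCast_le_dimH_of_forall_avoiding {d : ℕ} {ρ : ℝ} (hρ : 0 < ρ) (hρ1 : ρ ≤ 1)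
    (S : Set (Fin d → ℝ))
    (h : ∀ N : ℕ, 1 < N → ∃ r₀ > 0, ∃ D : ℕ → Set (Fin d → ℝ), (∀ x, (∀ t, x ∉ D t) → x ∈ S) ∧
      ∀ t z, ∃ z', closedBall z' (ρ * (r₀ * (ρ / (6 * N)) ^ t)) ⊆
        closedBall z (r₀ * (ρ / (6 * N)) ^ t) \ D t) :
    (d : ENNReal) ≤ dimH S := by
  have hlog : Tendsto (fun N : ℕ => log N) atTop atTop :=
    Real.tendsto_log_atTop.comp tendsto_natCast_atTop_atTop
  have hlim : Tendsto (fun N : ℕ => log N / log (6 * N / ρ)) atTop (𝓝 1) := by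
    have h1 : Tendsto (fun N : ℕ => (1 + log (6 / ρ) / log N)⁻¹) atTop (𝓝 1) := by
      have := (tendsto_const_nhds (x := (1 : ℝ))).add (hlog.const_div_atTop (log (6 / ρ)))
      simpa using this.inv₀ (by simp)
    refine h1.congr' ?_
    filter_upwards [eventually_gt_atTop 1] with N hN
    have hN0 : (0 : ℝ) < N := by positivity
    have hl : 0 < log N := Real.log_pos (by exact_mod_cast hN)
    rw [show 6 * (N : ℝ) / ρ = N * (6 / ρ) by ring, Real.log_mul hN0.ne' (by positivity)]
    rw [show 1 + log (6 / ρ) / log N = (log N + log (6 / ρ)) / log N by field_simp, inv_div]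
  have hlim' := ENNReal.Tendsto.const_mul (a := (d : ENNReal)) (ENNReal.tendsto_ofReal hlim)
    (Or.inr (by simp))
  rw [ENNReal.ofReal_one, mul_one] at hlim'
  refine le_of_tendsto hlim' ?_
  filter_upwards [eventually_gt_atTop 1] with N hN
  obtain ⟨r₀, hr₀, D, hS, hD⟩ := h N hN
  exact mul_log_div_log_le_dimH hN hρ hρ1 hr₀ S D hS hD

theorem distNearestInt_le (y : ℝ) (p : ℤ) : distNearestInt y ≤ |y - p| :=
  ciInf_le ⟨0, by rintro _ ⟨p, rfl⟩; exact abs_nonneg _⟩ p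

theorem distNearestInt_eq_abs_sub_round (y : ℝ) : distNearestInt y = |y - round y| :=
  le_antisymm (distNearestInt_le y _) (le_ciInf fun p => round_le y p)

theorem abs_le_supNorm {m : ℕ} (q : Fin m → ℤ) (j : Fin m) : |(q j : ℝ)| ≤ supNorm q :=
  le_ciSup (f := fun j => |(q j : ℝ)|) (Set.finite_range _).bddAbove j

theorem supNorm_nonneg {m : ℕ} (q : Fin m → ℤ) : 0 ≤ supNorm q :=
  Real.iSup_nonneg fun _ => abs_nonneg _

theorem one_le_supNorm {m : ℕ} {q : Fin m → ℤ} (hq : q ≠ 0) : 1 ≤ supNorm q := by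
  obtain ⟨j, hj⟩ := Function.ne_iff.1 hq
  refine le_trans ?_ (abs_le_supNorm q j)
  exact_mod_cast Int.one_le_abs hj

theorem supNorm_sub_le {m : ℕ} (q q' : Fin m → ℤ) : supNorm (q - q') ≤ supNorm q + supNorm q' := by
  refine Real.iSup_le (fun j => ?_) (add_nonneg (supNorm_nonneg q) (supNorm_nonneg q'))
  rw [Pi.sub_apply, Int.cast_sub]
  exact (abs_sub _ _).trans (add_le_add (abs_le_supNorm q j) (abs_le_supNorm q' j))

theorem linForm_sub {n m : ℕ} (Θ : Matrix (Fin n) (Fin m) ℝ) (q q' : Fin m → ℤ) (i : Fin n) :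
    linForm Θ (q - q') i = linForm Θ q i - linForm Θ q' i := by
  simp [linForm, sub_mul, Finset.sum_sub_distrib]

theorem IsWeight.le_one {n : ℕ} {k : Fin n → ℝ} (hk : IsWeight k) (i : Fin n) : k i ≤ 1 :=
  hk.2 ▸ Finset.single_le_sum (fun j _ => (hk.1 j).le) (Finset.mem_univ i)

/-- The points `Θ(q) - p` with `|q| ≤ R Q` are separated on the scale of the boxes with sides
`Q ^ (-m kᵢ)` when `Θ` is weighted badly approximable. -/
theorem exists_le_abs_sub_mul_rpow {n m : ℕ} (hn : 0 < n) {k : Fin n → ℝ} (hk : IsWeight k)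
    {Θ : Matrix (Fin n) (Fin m) ℝ} {c : ℝ}
    (hc : ∀ q : Fin m → ℤ, q ≠ 0 →
      c ≤ ⨆ i, supNorm q ^ ((m : ℝ) * k i) * distNearestInt (linForm Θ q i))
    {R Q : ℝ} (hR : 1 ≤ R) (hQ : 1 ≤ Q) {q q' : Fin m → ℤ} {p p' : Fin n → ℤ}
    (hq : supNorm q ≤ R * Q) (hq' : supNorm q' ≤ R * Q) (hne : q ≠ q' ∨ p ≠ p') :
    ∃ i, min c 1 / (2 * R) ^ m ≤
      |linForm Θ q i - p i - (linForm Θ q' i - p' i)| * Q ^ ((m : ℝ) * k i) := by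
  have hmk : ∀ i, 0 ≤ (m : ℝ) * k i := fun i => mul_nonneg m.cast_nonneg (hk.1 i).le
  by_cases h : q = q'
  · subst h
    obtain ⟨i, hi⟩ := Function.ne_iff.1 (hne.resolve_left fun h => h rfl)
    refine ⟨i, ?_⟩
    have h1 : (1 : ℝ) ≤ |linForm Θ q i - p i - (linForm Θ q i - p' i)| := by
      rw [sub_sub_sub_cancel_left]
      exact_mod_cast Int.one_le_abs (sub_ne_zero.2 hi.symm)
    have h2 : min c 1 / (2 * R) ^ m ≤ 1 := by
      rw [div_le_one (by positivity)]
      exact (min_le_right _ _).trans (one_le_pow₀ (by linarith))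
    exact h2.trans (one_le_mul_of_one_le_of_one_le h1 (Real.one_le_rpow hQ (hmk i)))
  · have : Nonempty (Fin n) := ⟨⟨0, hn⟩⟩
    obtain ⟨i, hi⟩ := exists_eq_ciSup_of_finite
      (f := fun i => supNorm (q - q') ^ ((m : ℝ) * k i) * distNearestInt (linForm Θ (q - q') i))
    have h1 := hc (q - q') (sub_ne_zero.2 h)
    rw [← hi] at h1
    refine ⟨i, ?_⟩
    rw [div_le_iff₀ (by positivity)]
    have h2 := distNearestInt_le (linForm Θ (q - q') i) (p i - p' i)
    have h3 : linForm Θ (q - q') i - ((p i - p' i : ℤ) : ℝ) =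
        linForm Θ q i - p i - (linForm Θ q' i - p' i) := by
      rw [linForm_sub]; push_cast; ring
    rw [h3] at h2
    have h4 : supNorm (q - q') ^ ((m : ℝ) * k i) ≤ Q ^ ((m : ℝ) * k i) * (2 * R) ^ m := by
      have h5 : supNorm (q - q') ≤ Q * (2 * R) := by linarith [supNorm_sub_le q q']
      refine (Real.rpow_le_rpow (supNorm_nonneg _) h5 (hmk i)).trans ?_
      rw [Real.mul_rpow (by positivity) (by positivity), ← Real.rpow_natCast (2 * R)]
      gcongr
      · linarith
      · exact mul_le_of_le_one_right m.cast_nonneg (hk.le_one i)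
    calc min c 1 ≤ c := min_le_left _ _
      _ ≤ _ := h1
      _ ≤ Q ^ ((m : ℝ) * k i) * (2 * R) ^ m *
          |linForm Θ q i - p i - (linForm Θ q' i - p' i)| :=
        mul_le_mul h4 h2 (by rw [distNearestInt_eq_abs_sub_round]; positivity) (by positivity)
      _ = _ := by ring

open Metric in
/-- Inside any ball there is a ball of comparable radius that stays away from the slab
`|ℓ - a| ≤ η`, where `ℓ` is a linear functional which does not vanish on `v`. -/
theorem exists_closedBall_subset_lt_abs_sub {E : Type*} [SeminormedAddCommGroup E]
    [NormedSpace ℝ E] (l : E →ₗ[ℝ] ℝ) {Λ : ℝ} (hΛ : 0 < Λ) (hl : ∀ z, |l z| ≤ Λ * ‖z‖) {v : E}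
    (hv : ‖v‖ ≤ 1) {r : ℝ} (hr : 0 < r) {η a : ℝ} (hη : η < r * |l v| / 2) (z : E) :
    ∃ z', closedBall z' (|l v| / (4 * Λ) * r) ⊆ closedBall z r ∧
      ∀ w ∈ closedBall z' (|l v| / (4 * Λ) * r), η < |l w - a| := by
  have hρ : |l v| / (4 * Λ) ≤ 1 / 4 := by
    rw [div_le_div_iff₀ (by positivity) (by norm_num)]
    nlinarith [hl v]
  obtain ⟨σ, hσ, hσ'⟩ : ∃ σ : ℝ, |σ| = 1 ∧ 3 / 4 * r * |l v| ≤ |l z + σ * (3 / 4 * r) * l v - a| := by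
    have h1 : |3 / 4 * r * l v| = 3 / 4 * r * |l v| := by
      rw [abs_mul, abs_of_pos (by positivity)]
    by_contra! hcon
    have h2 := hcon 1 (by simp)
    have h3 := hcon (-1) (by simp)
    have h4 := abs_sub (l z + 1 * (3 / 4 * r) * l v - a) (l z + -1 * (3 / 4 * r) * l v - a)
    rw [show l z + 1 * (3 / 4 * r) * l v - a - (l z + -1 * (3 / 4 * r) * l v - a) =
      2 * (3 / 4 * r * l v) by ring, abs_mul, h1, abs_two] at h4
    linarith
  refine ⟨z + (σ * (3 / 4 * r)) • v, ?_, fun w hw => ?_⟩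
  · apply closedBall_subset_closedBall'
    rw [dist_eq_norm, add_sub_cancel_left, norm_smul, Real.norm_eq_abs, abs_mul, hσ,
      abs_of_pos (by positivity : (0 : ℝ) < 3 / 4 * r)]
    nlinarith
  · have h1 := hl (w - (z + (σ * (3 / 4 * r)) • v))
    rw [mem_closedBall, dist_eq_norm] at hw
    have h2 : Λ * ‖w - (z + (σ * (3 / 4 * r)) • v)‖ ≤ r * |l v| / 4 := by
      refine (mul_le_mul_of_nonneg_left hw hΛ.le).trans (le_of_eq ?_)
      field_simp
    rw [map_sub, map_add, map_smul, smul_eq_mul] at h1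
    have h3 := abs_sub_abs_le_abs_sub (l z + σ * (3 / 4 * r) * l v - a) (l w - a)
    rw [sub_sub_sub_cancel_right, abs_sub_comm _ (l w)] at h3
    linarith

open Metric in
theorem natCast_le_dimH_setOf_add_mem_badT {n m d : ℕ} (hn : 0 < n) (hm : 0 < m) (hd : 0 < d)
    {k : Fin n → ℝ} (hk : IsWeight k) {Θ : Matrix (Fin n) (Fin m) ℝ} (hΘ : Θ ∈ Bad n m k)
    (L : (Fin d → ℝ) →L[ℝ] (Fin n → ℝ)) (hL : Function.Injective L) (x₀ : Fin n → ℝ) :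
    (d : ENNReal) ≤ dimH {z | x₀ + L z ∈ BadT n m k Θ} := by
  classical
  obtain ⟨c, hc0, hc⟩ := hΘ
  obtain ⟨I, ⟨v₀, hv₀⟩, hI⟩ : ∃ I, (∃ v, L v I ≠ 0) ∧ ∀ i, (∃ v, L v i ≠ 0) → k i ≤ k I := by
    have hne : (Finset.univ.filter fun i => ∃ v, L v i ≠ 0).Nonempty := by
      have : Nonempty (Fin d) := ⟨⟨0, hd⟩⟩
      obtain ⟨v, hv⟩ := exists_ne (0 : Fin d → ℝ)
      obtain ⟨i, hi⟩ := Function.ne_iff.1 ((map_ne_zero_iff L hL).2 hv)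
      exact ⟨i, by simpa using ⟨v, hi⟩⟩
    obtain ⟨I, hI, hmax⟩ := Finset.exists_max_image _ k hne
    exact ⟨I, by simpa using hI, fun i hi => hmax i (by simpa using hi)⟩
  have hLi : ∀ i z, |L z i| ≤ (‖L‖ + 1) * ‖z‖ := fun i z =>
    (norm_le_pi_norm (L z) i).trans ((L.le_opNorm z).trans (by gcongr; linarith))
  set Λ : ℝ := ‖L‖ + 1 with hΛdef
  have hΛ : 0 < Λ := by positivity
  let l : (Fin d → ℝ) →ₗ[ℝ] ℝ := LinearMap.proj I ∘ₗ L.toLinearMap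
  obtain ⟨v, hv, hlv⟩ : ∃ v, ‖v‖ ≤ 1 ∧ 0 < |l v| := by
    have hv0 : v₀ ≠ 0 := by rintro rfl; simp at hv₀
    refine ⟨‖v₀‖⁻¹ • v₀, ?_, ?_⟩
    · rw [norm_smul, norm_inv, norm_norm, inv_mul_cancel₀ (norm_ne_zero_iff.2 hv0)]
    · rw [map_smul, smul_eq_mul]
      exact abs_pos.2 (mul_ne_zero (inv_ne_zero (norm_ne_zero_iff.2 hv0)) hv₀)
  set ρ : ℝ := |l v| / (4 * Λ) with hρdef
  have hρ0 : 0 < ρ := by positivity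
  have hρ1 : ρ ≤ 1 := by
    rw [hρdef, div_le_one (by positivity)]
    have h1 : |l v| ≤ Λ * ‖v‖ := hLi I v
    nlinarith
  refine natCast_le_dimH_of_forall_avoiding hρ0 hρ1 _ fun N hN => ?_
  set β : ℝ := ρ / (6 * N) with hβdef
  have hN' : (1 : ℝ) < N := by exact_mod_cast hN
  have hβ0 : 0 < β := by positivity
  have hβ1 : β < 1 := by rw [hβdef, div_lt_one (by positivity)]; linarith
  have hmk : ∀ i, 0 < (m : ℝ) * k i := fun i => mul_pos (by exact_mod_cast hm) (hk.1 i)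
  set R : ℝ := β⁻¹ ^ ((m : ℝ) * k I)⁻¹ with hRdef
  have hR1 : 1 < R := Real.one_lt_rpow (one_lt_inv_iff₀.2 ⟨hβ0, hβ1⟩) (inv_pos.2 (hmk I))
  have hRt1 : ∀ t : ℕ, 1 ≤ R ^ t := fun t => one_le_pow₀ hR1.le
  have hRt : ∀ t : ℕ, (R ^ t) ^ ((m : ℝ) * k I) = (β ^ t)⁻¹ := by
    intro t
    rw [← Real.rpow_natCast, ← Real.rpow_mul (by positivity), mul_comm, Real.rpow_mul (by positivity),
      hRdef, Real.rpow_inv_rpow (by positivity) (hmk I).ne', Real.rpow_natCast, inv_pow]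
  set κ : ℝ := min c 1 / (2 * R) ^ m with hκdef
  have hκ0 : 0 < κ := div_pos (lt_min hc0 one_pos) (by positivity)
  set r₀ : ℝ := κ / (8 * Λ) with hr₀def
  have hr₀ : 0 < r₀ := by positivity
  set ε : ℝ := min (κ / 8) (r₀ * |l v| / 4) with hεdef
  have hε0 : 0 < ε := by positivity
  refine ⟨r₀, hr₀, fun t => {z | ∃ (q : Fin m → ℤ) (p : Fin n → ℤ), supNorm q ≤ R * R ^ t ∧
    ∀ i, |linForm Θ q i - (x₀ + L z) i - p i| * (R ^ t) ^ ((m : ℝ) * k i) ≤ ε}, ?_, ?_⟩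
  · intro z hz
    refine ⟨ε, hε0, fun q hq => ?_⟩
    by_contra! hlt
    obtain ⟨t, ht, ht'⟩ := exists_nat_pow_near (one_le_supNorm hq) hR1
    refine hz t ⟨q, fun i => round (linForm Θ q i - (x₀ + L z) i), ?_, fun i => ?_⟩
    · rw [← pow_succ']; exact ht'.le
    · rw [← distNearestInt_eq_abs_sub_round, mul_comm]
      refine le_trans ?_ ((le_ciSup (Set.finite_range _).bddAbove i).trans hlt.le)
      gcongr
      · rw [distNearestInt_eq_abs_sub_round]; positivity
      · exact (hmk i).le
  · intro t z
    have hβt : 0 < β ^ t := by positivity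
    have hslab : ∃ a, ∀ w ∈ closedBall z (r₀ * β ^ t), (∃ (q : Fin m → ℤ) (p : Fin n → ℤ),
        supNorm q ≤ R * R ^ t ∧
        ∀ i, |linForm Θ q i - (x₀ + L w) i - p i| * (R ^ t) ^ ((m : ℝ) * k i) ≤ ε) →
        |l w - a| ≤ ε * β ^ t := by
      by_cases hex : ∃ w ∈ closedBall z (r₀ * β ^ t), ∃ (q : Fin m → ℤ) (p : Fin n → ℤ),
        supNorm q ≤ R * R ^ t ∧
        ∀ i, |linForm Θ q i - (x₀ + L w) i - p i| * (R ^ t) ^ ((m : ℝ) * k i) ≤ ε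
      · obtain ⟨w, hw, q, p, hq, hqp⟩ := hex
        refine ⟨linForm Θ q I - p I - x₀ I, ?_⟩
        rintro w' hw' ⟨q', p', hq', hqp'⟩
        have heq : ¬ (q' ≠ q ∨ p' ≠ p) := by
          intro hne
          obtain ⟨i, hi⟩ := exists_le_abs_sub_mul_rpow hn hk hc hR1.le (hRt1 t) hq' hq hne
          rw [← hκdef] at hi
          set T := (R ^ t) ^ ((m : ℝ) * k i) with hT
          have hT0 : 0 < T := by positivity
          have hdiff : |L w' i - L w i| * T ≤ κ / 4 := by
            by_cases hcst : ∃ u, L u i ≠ 0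
            · have h1 : T ≤ (β ^ t)⁻¹ := by
                rw [← hRt]
                exact Real.rpow_le_rpow_of_exponent_le (hRt1 t)
                  (mul_le_mul_of_nonneg_left (hI i hcst) m.cast_nonneg)
              have h2 : |L w' i - L w i| ≤ Λ * (2 * (r₀ * β ^ t)) := by
                rw [← Pi.sub_apply, ← map_sub]
                refine (hLi i _).trans (mul_le_mul_of_nonneg_left ?_ hΛ.le)
                rw [← dist_eq_norm]
                linarith [dist_triangle_right w' w z, mem_closedBall.1 hw, mem_closedBall.1 hw']
              calc _ ≤ Λ * (2 * (r₀ * β ^ t)) * (β ^ t)⁻¹ := by gcongr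
                _ = κ / 4 := by rw [hr₀def]; field_simp; norm_num
            · push Not at hcst
              rw [hcst w, hcst w', sub_zero, abs_zero, zero_mul]
              positivity
          have h1 := hqp i
          have h2 := hqp' i
          have h3 : |linForm Θ q' i - p' i - (linForm Θ q i - p i)| ≤
              |linForm Θ q' i - (x₀ + L w') i - p' i| + |L w' i - L w i| +
              |linForm Θ q i - (x₀ + L w) i - p i| := by
            have h4 : linForm Θ q' i - p' i - (linForm Θ q i - p i) =
              (linForm Θ q' i - (x₀ + L w') i - p' i) + (L w' i - L w i) -
              (linForm Θ q i - (x₀ + L w) i - p i) := by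
              simp only [Pi.add_apply]; ring
            rw [h4]
            exact (abs_sub _ _).trans (add_le_add_left (abs_add_le _ _) _)
          have h5 : ε ≤ κ / 8 := min_le_left _ _
          have h6 := mul_le_mul_of_nonneg_right h3 hT0.le
          linarith
        obtain ⟨rfl, rfl⟩ : q' = q ∧ p' = p := by tauto
        have h1 := hqp' I
        rw [hRt, ← div_eq_mul_inv, div_le_iff₀ hβt] at h1
        rw [abs_sub_comm, show linForm Θ q' I - p' I - x₀ I - l w' =
          linForm Θ q' I - (x₀ + L w') I - p' I by
            rw [Pi.add_apply, show l w' = L w' I from rfl]; ring]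
        exact h1
      · push Not at hex
        refine ⟨0, fun w hw ⟨q, p, hq, hqp⟩ => ?_⟩
        obtain ⟨i, hi⟩ := hex w hw q p hq
        exact absurd (hqp i) hi.not_ge
    obtain ⟨a, ha⟩ := hslab
    obtain ⟨z', hz', hz''⟩ := exists_closedBall_subset_lt_abs_sub l hΛ (hLi I) hv
      (r := r₀ * β ^ t) (η := ε * β ^ t) (a := a) (by positivity)
      (by
        have : ε ≤ r₀ * |l v| / 4 := min_le_right _ _
        nlinarith [mul_pos (mul_pos hr₀ hlv) hβt]) z
    exact ⟨z', fun w hw => ⟨hz' hw, fun hmem => (ha w (hz' hw) hmem).not_gt (hz'' w hw)⟩⟩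

/-- If `Θ ∈ Bad(k,n,m)`, then for every `1 ≤ d ≤ n` and every
`d`-dimensional affine subspace `A ⊆ ℝⁿ`, `dim_H (Bad_Θ(k,n,m) ∩ A) = d`. -/
theorem badT_inter_affine_dimH {n m : ℕ} (hn : 0 < n) (hm : 0 < m)
    (k : Fin n → ℝ) (hk : IsWeight k)
    (Θ : Matrix (Fin n) (Fin m) ℝ) (hΘ : Θ ∈ Bad n m k)
    (d : ℕ) (hd : 1 ≤ d) (hdn : d ≤ n)
    (A : AffineSubspace ℝ (Fin n → ℝ))
    (hA : Module.finrank ℝ A.direction = d) :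
    dimH (BadT n m k Θ ∩ (A : Set (Fin n → ℝ))) = d := by
  have hne : (A : Set (Fin n → ℝ)).Nonempty := by
    rw [Set.nonempty_iff_ne_empty, Ne, AffineSubspace.coe_eq_bot_iff]
    rintro rfl
    rw [AffineSubspace.direction_bot, finrank_bot] at hA
    omega
  obtain ⟨x₀, hx₀⟩ := hne
  have hlow : (d : ENNReal) ≤ dimH (BadT n m k Θ ∩ (A : Set (Fin n → ℝ))) := by
    let e : (Fin d → ℝ) ≃L[ℝ] A.direction :=
      ContinuousLinearEquiv.ofFinrankEq (by rw [hA, Module.finrank_fin_fun])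
    let L : (Fin d → ℝ) →L[ℝ] (Fin n → ℝ) := A.direction.subtypeL ∘L e.toContinuousLinearMap
    have hL : Function.Injective L := Subtype.val_injective.comp e.injective
    refine (natCast_le_dimH_setOf_add_mem_badT hn hm hd hk hΘ L hL x₀).trans ?_
    obtain ⟨K, -, hK⟩ := L.toLinearMap.exists_antilipschitzWith (LinearMap.ker_eq_bot.2 hL)
    have hK' : AntilipschitzWith K fun z => x₀ + L z := fun z w => by
      simpa [edist_add_left] using hK z w
    refine (hK'.le_dimH_image _).trans (dimH_mono ?_)
    rintro _ ⟨z, hz, rfl⟩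
    refine ⟨hz, ?_⟩
    have := AffineSubspace.vadd_mem_of_mem_direction (e z).2 hx₀
    rwa [vadd_eq_add, add_comm] at this
  refine le_antisymm ?_ hlow
  have hsub : BadT n m k Θ ∩ (A : Set (Fin n → ℝ)) ⊆
      Set.range fun u : A.direction => (u : Fin n → ℝ) + x₀ := by
    rintro x ⟨-, hx⟩
    exact ⟨⟨x - x₀, AffineSubspace.vsub_mem_direction hx hx₀⟩, sub_add_cancel x x₀⟩
  refine (dimH_mono hsub).trans ?_
  have hiso : Isometry fun u : A.direction => (u : Fin n → ℝ) + x₀ :=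
    (IsometryEquiv.addRight x₀).isometry.comp isometry_subtype_coe
  rw [← Set.image_univ, hiso.dimH_image, Real.dimH_univ_eq_finrank, hA]
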